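/- Let F be a finitely generated R-module and {G_λ}_{λ∈Λ} a nonempty family of submodules of F such that for all λ₁, λ₂ ∈ Λ there exists λ ∈ Λ with G_λ ⊆ G_{λ₁} ∩ G_{λ₂}. Set G := ⋂_{λ∈Λ} G_λ. Assume that for every prime ideal 𝔭 of R one has Ĝ_𝔭 = ⋂_{λ∈Λ} (G_λ)^̂_𝔭 as submodules of F̂_𝔭. Then there exists λ₀ ∈ Λ such that G = G_λ for every λ ∈ Λ with G_λ ⊆ G_{λ₀}; in particular the intersection defining G stabilizes. -/

import Mathlib

open scoped TensorProduct

/-!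
For a prime `𝔭` of a commutative ring `R`, `primeCompletion 𝔭` is the completion
`R̂_𝔭` of the localization `R_𝔭` with respect to its maximal ideal.  For a finitely
generated `R`-module `F` and a submodule `N ⊆ F`, the completed stalk
`N̂_𝔭 ⊆ F̂_𝔭 = R̂_𝔭 ⊗_R F` is the `R̂_𝔭`-submodule generated by the image of `N`, i.e.
`Submodule.baseChange (primeCompletion 𝔭) N`.
-/

/-- The `𝔭`-adic completion `R̂_𝔭` of the localization of `R` at a prime `𝔭`. -/
abbrev primeCompletion {R : Type*} [CommRing R] (𝔭 : Ideal R) [𝔭.IsPrime] : Type _ :=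
  AdicCompletion (IsLocalRing.maximalIdeal (Localization.AtPrime 𝔭)) (Localization.AtPrime 𝔭)

noncomputable instance primeCompletionAlgebra {R : Type*} [CommRing R] (𝔭 : Ideal R)
    [𝔭.IsPrime] : Algebra R (primeCompletion 𝔭) :=
  ((algebraMap (Localization.AtPrime 𝔭) (primeCompletion 𝔭)).comp
    (algebraMap R (Localization.AtPrime 𝔭))).toAlgebra

/-- A completed stalk detects the vanishing of an element of the uncompleted one. -/
theorem exists_smul_eq_zero_of_one_tmul_eq_zero {R : Type*} [CommRing R] [IsNoetherianRing R]
    {M : Type*} [AddCommGroup M] [Module R M] [Module.Finite R M] (𝔭 : Ideal R) [𝔭.IsPrime]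
    {S : Type*} [CommRing S] [Algebra R S] (e : S →+* primeCompletion 𝔭)
    (he : ∀ r, e (algebraMap R S r) = algebraMap (Localization.AtPrime 𝔭) (primeCompletion 𝔭)
      (algebraMap R (Localization.AtPrime 𝔭) r))
    {x : M} (hx : (1 : S) ⊗ₜ[R] x = 0) : ∃ s ∉ 𝔭, s • x = 0 := by
  let L := Localization.AtPrime 𝔭
  let m := IsLocalRing.maximalIdeal L
  let N := LocalizedModule 𝔭.primeCompl M
  let φ : M →ₗ[R] N := LocalizedModule.mkLinearMap 𝔭.primeCompl M
  have : IsNoetherianRing L := IsLocalization.isNoetherianRing 𝔭.primeCompl L inferInstance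
  have : Module.Finite L N := Module.Finite.of_isLocalizedModule 𝔭.primeCompl φ
  let f : S →+ M →+ AdicCompletion m N :=
    { toFun := fun a => (DistribSMul.toAddMonoidHom _ (e a)).comp
        ((AdicCompletion.of m N).toAddMonoidHom.comp φ.toAddMonoidHom)
      map_zero' := by ext1; simp
      map_add' := fun a b => by ext1; simp [add_smul] }
  have hf (r : R) (a : S) (y : M) : f (r • a) y = f a (r • y) := by
    change e (r • a) • AdicCompletion.of m N (φ y) = e a • AdicCompletion.of m N (φ (r • y))
    have h : φ (r • y) = algebraMap R L r • φ y := by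
      rw [map_smul, algebraMap_smul]
    rw [h, Algebra.smul_def, map_mul, he, map_smul, mul_comm, mul_smul]
    exact congrArg (e a • ·) (algebraMap_smul _ _ _)
  have h0 := congrArg (TensorProduct.liftAddHom f hf) hx
  rw [TensorProduct.liftAddHom_tmul, map_zero] at h0
  change e 1 • AdicCompletion.of m N (φ x) = 0 at h0
  rw [map_one, one_smul, ← map_zero (AdicCompletion.of m N), AdicCompletion.of_inj] at h0
  obtain ⟨s, hs⟩ := (IsLocalizedModule.eq_zero_iff 𝔭.primeCompl φ).1 h0
  exact ⟨s, s.2, hs⟩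

theorem exists_smul_mem_of_one_tmul_mem_baseChange {R : Type*} [CommRing R] [IsNoetherianRing R]
    {M : Type*} [AddCommGroup M] [Module R M] [Module.Finite R M] (𝔭 : Ideal R) [𝔭.IsPrime]
    {S : Type*} [CommRing S] [Algebra R S] (e : S →+* primeCompletion 𝔭)
    (he : ∀ r, e (algebraMap R S r) = algebraMap (Localization.AtPrime 𝔭) (primeCompletion 𝔭)
      (algebraMap R (Localization.AtPrime 𝔭) r))
    {N : Submodule R M} {x : M} (hx : (1 : S) ⊗ₜ[R] x ∈ N.baseChange S) :
    ∃ s ∉ 𝔭, s • x ∈ N := by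
  have h : N.baseChange S ≤ LinearMap.ker (N.mkQ.baseChange S) := by
    rw [Submodule.baseChange_eq_span, Submodule.span_le]
    rintro _ ⟨y, hy, rfl⟩
    simp [(Submodule.Quotient.mk_eq_zero N).2 hy]
  have h' := h hx
  rw [LinearMap.mem_ker, LinearMap.baseChange_tmul] at h'
  obtain ⟨s, hs, hsx⟩ := exists_smul_eq_zero_of_one_tmul_eq_zero 𝔭 e he h'
  exact ⟨s, hs, (Submodule.Quotient.mk_eq_zero N).1 (by simpa using hsx)⟩

theorem one_tmul_mem_baseChange_of_smul_mem {R : Type*} [CommRing R]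
    {M : Type*} [AddCommGroup M] [Module R M] {S : Type*} [CommRing S] [Algebra R S]
    {N : Submodule R M} {x : M} {s : R} (hs : IsUnit (algebraMap R S s)) (hx : s • x ∈ N) :
    (1 : S) ⊗ₜ[R] x ∈ N.baseChange S := by
  obtain ⟨u, hu⟩ := hs
  have h : (1 : S) ⊗ₜ[R] x = (↑u⁻¹ : S) ⊗ₜ[R] (s • x) := by
    rw [← TensorProduct.smul_tmul, Algebra.smul_def, ← hu, Units.mul_inv]
  rw [h]
  exact Submodule.tmul_mem_baseChange_of_mem _ hx

/-- If the completed stalk at `𝔭` of `⨅ i, G i` is the intersection of the completed stalks of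
the `G i`, then the same holds for the uncompleted stalks. The ring `S` is a copy of the completion
carrying a specified `R`-algebra structure. -/
theorem exists_smul_mem_iInf_of_baseChange_iInf {R : Type*} [CommRing R] [IsNoetherianRing R]
    {M : Type*} [AddCommGroup M] [Module R M] [Module.Finite R M] (𝔭 : Ideal R) [𝔭.IsPrime]
    {S : Type*} [CommRing S] [Algebra R S] (e : S ≃+* primeCompletion 𝔭)
    (he : ∀ r, e (algebraMap R S r) = algebraMap (Localization.AtPrime 𝔭) (primeCompletion 𝔭)
      (algebraMap R (Localization.AtPrime 𝔭) r))
    {ι : Type*} {G : ι → Submodule R M}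
    (hG : (⨅ i, G i).baseChange S = ⨅ i, (G i).baseChange S)
    {x : M} (hx : ∀ i, ∃ s ∉ 𝔭, s • x ∈ G i) : ∃ s ∉ 𝔭, s • x ∈ ⨅ i, G i := by
  refine exists_smul_mem_of_one_tmul_mem_baseChange 𝔭 e.toRingHom he ?_
  rw [hG, Submodule.mem_iInf]
  intro i
  obtain ⟨s, hs, hsx⟩ := hx i
  refine one_tmul_mem_baseChange_of_smul_mem ?_ hsx
  rw [← MulEquiv.isUnit_map e, he]
  exact (IsLocalization.map_units (Localization.AtPrime 𝔭) (⟨s, hs⟩ : 𝔭.primeCompl)).map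
    (algebraMap (Localization.AtPrime 𝔭) (primeCompletion 𝔭))

theorem exists_forall_le_exists_smul_mem {A : Type*} [CommRing A] [IsDomain A]
    [IsNoetherianRing A] {P : Type*} [AddCommGroup P] [Module A P] [Module.Finite A P]
    {ι : Type*} [Nonempty ι] (Q : ι → Submodule A P) :
    ∃ i₀, ∀ i, Q i ≤ Q i₀ → ∀ x ∈ Q i₀, ∃ a ≠ (0 : A), a • x ∈ Q i := by
  obtain ⟨i₀, h₀⟩ := exists_minimal_of_wellFoundedLT (fun n => ∃ i, Module.finrank A (Q i) = n)
    ⟨_, Classical.arbitrary ι, rfl⟩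
  obtain ⟨⟨i₀, rfl⟩, hmin⟩ := h₀
  refine ⟨i₀, fun i hi x hx => ?_⟩
  have hle := Submodule.finrank_mono hi
  have heq := hle.antisymm (hmin ⟨i, rfl⟩ hle)
  have hrank := ((Q i).submoduleOf (Q i₀)).finrank_quotient_add_finrank
  rw [(Submodule.submoduleOfEquivOfLe hi).finrank_eq, heq, Nat.add_eq_right,
    Module.finrank_eq_zero_iff_isTorsion] at hrank
  obtain ⟨a, ha⟩ := @hrank (Submodule.Quotient.mk ⟨x, hx⟩)
  refine ⟨a, nonZeroDivisors.ne_zero a.2, ?_⟩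
  exact (Submodule.Quotient.mk_eq_zero ((Q i).submoduleOf (Q i₀))).1 ha

theorem exists_mem_iInter_associatedPrimes {R : Type*} [CommRing R] [IsNoetherianRing R]
    {M : Type*} [AddCommGroup M] [Module R M] [Module.Finite R M]
    {ι : Type*} [Nonempty ι] (N : ι → Submodule R M)
    (hdir : Directed (· ≥ ·) N) (hN : ∀ i, N i ≠ ⊥) :
    ∃ 𝔭, ∀ i, 𝔭 ∈ associatedPrimes R (N i) := by
  classical
  by_contra! h
  choose c hc using h
  obtain ⟨k, hk⟩ := hdir.finset_le ((associatedPrimes.finite R M).toFinset.image c)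
  have : Nontrivial (N k) := Submodule.nontrivial_iff_ne_bot.2 (hN k)
  obtain ⟨𝔭, h𝔭⟩ := associatedPrimes.nonempty R (N k)
  have hM : 𝔭 ∈ associatedPrimes R M :=
    associatedPrimes.subset_of_injective (N k).injective_subtype h𝔭
  have hle : N k ≤ N (c 𝔭) := hk _ (Finset.mem_image_of_mem c (by simpa using hM))
  exact hc 𝔭 (associatedPrimes.subset_of_injective (Submodule.inclusion_injective hle) h𝔭)

theorem exists_prime_forall_exists_smul_mem {R : Type*} [CommRing R] [IsNoetherianRing R]
    {M : Type*} [AddCommGroup M] [Module R M] [Module.Finite R M]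
    {ι : Type*} [Nonempty ι] (N : ι → Submodule R M)
    (hdir : Directed (· ≥ ·) N) (hN : ∀ i, N i ≠ ⊥) :
    ∃ 𝔭 : Ideal R, 𝔭.IsPrime ∧ ∃ x : M, (∀ s ∉ 𝔭, s • x ≠ 0) ∧ ∀ i, ∃ s ∉ 𝔭, s • x ∈ N i := by
  obtain ⟨𝔭, h𝔭⟩ := exists_mem_iInter_associatedPrimes N hdir hN
  have hp : 𝔭.IsPrime := (h𝔭 (Classical.arbitrary ι)).isPrime
  let P := Submodule.torsionBySet R M 𝔭
  have : Module.Finite (R ⧸ 𝔭) P := Module.Finite.of_restrictScalars_finite R _ _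
  let Q (i : ι) : Submodule (R ⧸ 𝔭) P :=
    { carrier := {y | (y : M) ∈ N i}
      add_mem' := fun ha hb => (N i).add_mem ha hb
      zero_mem' := (N i).zero_mem
      smul_mem' := fun a y hy => by
        obtain ⟨r, rfl⟩ := Ideal.Quotient.mk_surjective a
        exact (N i).smul_mem r hy }
  obtain ⟨i₀, hi₀⟩ := exists_forall_le_exists_smul_mem Q
  obtain ⟨-, x, hx⟩ := isAssociatedPrime_iff.1 (h𝔭 i₀)
  have hann (r : R) : r ∈ 𝔭 ↔ r • (x : M) = 0 := by
    rw [hx, Submodule.mem_colon_singleton, Submodule.mem_bot, ← Submodule.coe_smul,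
      ZeroMemClass.coe_eq_zero]
  have hxP : (x : M) ∈ P := (Submodule.mem_torsionBySet_iff _ _).2 fun r => (hann r).1 r.2
  refine ⟨𝔭, hp, x, fun s hs h => hs ((hann s).2 h), fun j => ?_⟩
  obtain ⟨k, hki, hkj⟩ := hdir i₀ j
  obtain ⟨a, ha, hax⟩ := hi₀ k (fun y hy => hki hy) ⟨x, hxP⟩ x.2
  obtain ⟨r, rfl⟩ := Ideal.Quotient.mk_surjective a
  exact ⟨r, fun hr => ha (Ideal.Quotient.eq_zero_iff_mem.2 hr), hkj hax⟩

/-- Let `F` be a finitely generated `R`-module and `{G_λ}_{λ∈Λ}` a nonempty family of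
submodules of `F` such that for all `λ₁, λ₂ ∈ Λ` there exists `λ ∈ Λ` with
`G_λ ⊆ G_{λ₁} ∩ G_{λ₂}`.  Set `G := ⋂_{λ∈Λ} G_λ`.  Assume that for every prime ideal `𝔭`
of `R` one has `Ĝ_𝔭 = ⋂_{λ∈Λ} (G_λ)̂_𝔭` as submodules of `F̂_𝔭`.  Then there exists
`λ₀ ∈ Λ` such that `G = G_λ` for every `λ ∈ Λ` with `G_λ ⊆ G_{λ₀}`; in particular the
intersection defining `G` stabilizes. -/
theorem statement_3
    {R : Type*} [CommRing R] [IsNoetherianRing R]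
    (F : Type*) [AddCommGroup F] [Module R F] [Module.Finite R F]
    {ι : Type*} [Nonempty ι] (G : ι → Submodule R F)
    (hdir : ∀ i j : ι, ∃ k : ι, G k ≤ G i ⊓ G j)
    (hstalk : ∀ (𝔭 : Ideal R) [𝔭.IsPrime],
      Submodule.baseChange (primeCompletion 𝔭) (⨅ i : ι, G i) =
        ⨅ i : ι, Submodule.baseChange (primeCompletion 𝔭) (G i)) :
    ∃ i₀ : ι, ∀ i : ι, G i ≤ G i₀ → (⨅ j : ι, G j) = G i := by
  suffices h : ∃ i₀, G i₀ ≤ ⨅ j, G j from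
    h.imp fun i₀ h₀ i hi => (iInf_le G i).antisymm (hi.trans h₀)
  by_contra! hne
  set H : Submodule R F := ⨅ j, G j with hH
  have hN (i : ι) : (G i).map H.mkQ ≠ ⊥ := by
    rw [Ne, ← LinearMap.le_ker_iff_map, Submodule.ker_mkQ]
    exact hne i
  have hdirN : Directed (· ≥ ·) fun i => (G i).map H.mkQ := fun i j =>
    (hdir i j).imp fun k hk =>
      ⟨Submodule.map_mono (hk.trans inf_le_left), Submodule.map_mono (hk.trans inf_le_right)⟩
  obtain ⟨𝔭, hp, x, hx, hxN⟩ := exists_prime_forall_exists_smul_mem _ hdirN hN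
  obtain ⟨y, rfl⟩ := H.mkQ_surjective x
  have hy (i : ι) : ∃ s ∉ 𝔭, s • y ∈ G i := by
    obtain ⟨s, hs, z, hz, hzy⟩ := hxN i
    refine ⟨s, hs, ?_⟩
    rw [← map_smul, ← sub_eq_zero, ← map_sub, Submodule.mkQ_apply,
      Submodule.Quotient.mk_eq_zero] at hzy
    simpa using (G i).sub_mem hz (iInf_le G i hzy)
  obtain ⟨s, hs, hsy⟩ := exists_smul_mem_iInf_of_baseChange_iInf 𝔭
    (RingEquiv.refl (primeCompletion 𝔭)) (fun _ => rfl) (hstalk 𝔭) hy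
  exact hx s hs (by rwa [← map_smul, Submodule.mkQ_apply, Submodule.Quotient.mk_eq_zero])
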